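/- Let ξ : ℝⁿ → ℝⁿ be a C^∞ vector field with compact support, and let Φ_τ be its flow, i.e. ∂_τ Φ_τ(y) = ξ(Φ_τ(y)) for all τ ∈ ℝ with Φ_0 = id. Let ρ : ℝⁿ → [0,∞) be a probability density with ∫ ρ |log ρ| dx < ∞, and for τ ∈ ℝ let ρ_τ denote the density of the push-forward of the measure ρ(y) dy under Φ_τ, so that ρ_τ(Φ_τ(y)) det ∇Φ_τ(y) = ρ(y). Then the entropy S(ρ_τ) = ∫ ρ_τ log ρ_τ dx is differentiable in τ at τ = 0, with d/dτ [S(ρ_τ)]_{τ=0} = −∫_{ℝⁿ} ρ(y) div ξ(y) dy. -/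

import Mathlib

open MeasureTheory Set Filter Topology

section Det

variable {n : ℕ}

theorem EuclideanSpace.clm_det_eq (A : EuclideanSpace ℝ (Fin n) →L[ℝ] EuclideanSpace ℝ (Fin n)) :
    A.det = Matrix.det (Matrix.of fun i j => A (EuclideanSpace.single j 1) i) := by
  rw [ContinuousLinearMap.det, ← LinearMap.det_toMatrix (EuclideanSpace.basisFun (Fin n) ℝ).toBasis]
  congr 1

theorem EuclideanSpace.contDiff_clm_det : ContDiff ℝ 1
    (fun A : EuclideanSpace ℝ (Fin n) →L[ℝ] EuclideanSpace ℝ (Fin n) => A.det) := by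
  simp only [EuclideanSpace.clm_det_eq, Matrix.det_apply, Matrix.of_apply]
  fun_prop

/-- **Jacobi's formula** at the identity, in logarithmic form. -/
theorem EuclideanSpace.hasDerivAt_log_det
    {A : ℝ → EuclideanSpace ℝ (Fin n) →L[ℝ] EuclideanSpace ℝ (Fin n)}
    {B : EuclideanSpace ℝ (Fin n) →L[ℝ] EuclideanSpace ℝ (Fin n)} (hA0 : A 0 = 1)
    (hA : HasDerivAt A B 0) :
    HasDerivAt (fun t => Real.log (A t).det) (∑ i, B (EuclideanSpace.single i 1) i) 0 := by
  have hdiff : DifferentiableAt ℝ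
      (fun A : EuclideanSpace ℝ (Fin n) →L[ℝ] EuclideanSpace ℝ (Fin n) => A.det) 1 :=
    EuclideanSpace.contDiff_clm_det.differentiable one_ne_zero 1
  have hdet : fderiv ℝ (fun A : EuclideanSpace ℝ (Fin n) →L[ℝ] EuclideanSpace ℝ (Fin n) => A.det) 1
      B = ∑ i, B (EuclideanSpace.single i 1) i := by
    have hline : HasDerivAt (fun t : ℝ => 1 + t • B) B 0 := by
      simpa using ((hasDerivAt_id (0 : ℝ)).smul_const B).const_add 1
    have h1 := HasFDerivAt.comp_hasDerivAt_of_eq (0 : ℝ) hdiff.hasFDerivAt hline (by ext; simp)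
    set M : Matrix (Fin n) (Fin n) ℝ := Matrix.of fun i j => B (EuclideanSpace.single j 1) i
    have h2 : ∀ t : ℝ, (1 + t • B).det = 1 + M.trace * t +
        (Matrix.det (1 + (Polynomial.X : Polynomial ℝ) • M.map Polynomial.C)).divX.divX.eval t
          * t ^ 2 := by
      intro t
      rw [← Matrix.det_one_add_smul, EuclideanSpace.clm_det_eq]
      congr 1
      ext i j
      simp [M, Matrix.one_apply]
    have h3 : HasDerivAt (fun t : ℝ => 1 + M.trace * t +
        (Matrix.det (1 + (Polynomial.X : Polynomial ℝ) • M.map Polynomial.C)).divX.divX.eval t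
          * t ^ 2) M.trace 0 := by
      have := (((hasDerivAt_id (0 : ℝ)).const_mul M.trace).const_add 1).add
        ((Polynomial.hasDerivAt (Matrix.det
          (1 + (Polynomial.X : Polynomial ℝ) • M.map Polynomial.C)).divX.divX 0).mul
            (hasDerivAt_pow 2 (0 : ℝ)))
      simpa using! this
    have h4 := h3.congr_of_eventuallyEq (Eventually.of_forall h2)
    exact h1.unique h4
  have h := HasFDerivAt.comp_hasDerivAt_of_eq (0 : ℝ) hdiff.hasFDerivAt hA hA0.symm
  rw [hdet] at h
  have hone : (A 0).det = 1 := hA0 ▸ LinearMap.det_id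
  simpa [hone] using! h.log (by simp [hone])

/-- Near the identity, `det` is positive and `log det` is Lipschitz. -/
theorem EuclideanSpace.exists_abs_log_det_le : ∃ δ > (0 : ℝ), ∃ C : ℝ,
    ∀ A : EuclideanSpace ℝ (Fin n) →L[ℝ] EuclideanSpace ℝ (Fin n), ‖A - 1‖ < δ →
      0 < A.det ∧ |Real.log A.det| ≤ C * ‖A - 1‖ := by
  have hone : (1 : EuclideanSpace ℝ (Fin n) →L[ℝ] EuclideanSpace ℝ (Fin n)).det = 1 :=
    LinearMap.det_id
  have hc := (EuclideanSpace.contDiff_clm_det (n := n)).contDiffAt (x := 1)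
  have hlog := hc.log (by simp [hone])
  obtain ⟨K, t, ht, hK⟩ := hlog.exists_lipschitzOnWith
  have hpos : ∀ᶠ A in 𝓝 (1 : EuclideanSpace ℝ (Fin n) →L[ℝ] EuclideanSpace ℝ (Fin n)),
      0 < A.det := hc.continuousAt.eventually (lt_mem_nhds (by simp [hone]))
  obtain ⟨δ, hδ, hball⟩ := Metric.mem_nhds_iff.1 (inter_mem ht hpos)
  refine ⟨δ, hδ, K, fun A hA => ?_⟩
  have hA' := hball (mem_ball_iff_norm.2 hA)
  refine ⟨hA'.2, ?_⟩
  simpa [hone] using hK.norm_sub_le hA'.1 (mem_of_mem_nhds ht)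

end Det

section Gronwall

variable {F : Type*} [NormedAddCommGroup F] [NormedSpace ℝ F]

/-- Two-sided **Grönwall inequality** around time `0`. -/
theorem norm_le_gronwallBound_abs {w w' : ℝ → F} {δ K η ε : ℝ}
    (hw : ∀ t, |t| < ε → HasDerivAt w (w' t) t) (h0 : ‖w 0‖ ≤ δ)
    (bound : ∀ t, |t| < ε → ‖w' t‖ ≤ K * ‖w t‖ + η) {t : ℝ} (ht : |t| < ε) :
    ‖w t‖ ≤ gronwallBound δ K η |t| := by
  have key : ∀ {v v' : ℝ → F}, (∀ t, |t| < ε → HasDerivAt v (v' t) t) → ‖v 0‖ ≤ δ →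
      (∀ t, |t| < ε → ‖v' t‖ ≤ K * ‖v t‖ + η) → ∀ s, 0 ≤ s → s < ε →
      ‖v s‖ ≤ gronwallBound δ K η s := by
    intro v v' hv hv0 hb s hs hsε
    have hmem : ∀ x ∈ Icc (0 : ℝ) s, |x| < ε := fun x hx => by
      rw [abs_of_nonneg hx.1]; exact hx.2.trans_lt hsε
    simpa using norm_le_gronwallBound_of_norm_deriv_right_le (a := 0) (b := s)
      (fun x hx => (hv x (hmem x hx)).continuousAt.continuousWithinAt)
      (fun x hx => (hv x (hmem x ⟨hx.1, hx.2.le⟩)).hasDerivWithinAt) hv0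
      (fun x hx => hb x (hmem x ⟨hx.1, hx.2.le⟩)) s (right_mem_Icc.2 hs)
  rcases le_total 0 t with h | h
  · rw [abs_of_nonneg h] at ht ⊢
    exact key hw h0 bound t h ht
  · rw [abs_of_nonpos h] at ht ⊢
    have := key (v := fun s => w (-s)) (v' := fun s => -w' (-s))
      (fun s hs => by
        simpa using! (hw (-s) (by rwa [abs_neg])).scomp s (hasDerivAt_neg s))
      (by simpa using h0) (fun s hs => by simpa using bound (-s) (by rwa [abs_neg]))
      (-t) (by linarith) ht
    simpa using this

theorem gronwallBound_zero_mul (K a b x : ℝ) :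
    gronwallBound 0 K (a * b) x = gronwallBound 0 K a x * b := by
  unfold gronwallBound
  split_ifs <;> ring

open NNReal in
/-- The linear equation `A' = B A`, `A 0 = 1` has a solution on a time interval
depending only on a bound for the coefficients. -/
theorem exists_linear_ode_solution [CompleteSpace F] {B : ℝ → F →L[ℝ] F} (hB : Continuous B)
    {K : ℝ≥0} (hK : ∀ t, ‖B t‖ ≤ K) :
    ∃ A : ℝ → F →L[ℝ] F, A 0 = 1 ∧
      ∀ t, |t| < (2 * K + 1 : ℝ)⁻¹ → HasDerivAt A (B t * A t) t := by
  set ε : ℝ := (2 * K + 1 : ℝ)⁻¹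
  have hε : 0 < ε := by positivity
  have hpl : IsPicardLindelof (fun t (A : F →L[ℝ] F) => B t * A) (tmin := -ε) (tmax := ε)
      ⟨0, by simp [hε.le]⟩ 1 1 0 (2 * K) K := by
    refine ⟨fun t _ => ?_, fun A _ => ?_, fun t _ A hA => ?_, ?_⟩
    · refine LipschitzOnWith.of_dist_le_mul fun A _ A' _ => ?_
      rw [dist_eq_norm, dist_eq_norm, ← mul_sub]
      exact (norm_mul_le _ _).trans (by gcongr; exact hK t)
    · exact (hB.mul continuous_const).continuousOn
    · have hA2 : ‖A‖ ≤ 2 := by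
        have h1 : ‖A - 1‖ ≤ 1 := by simpa [dist_eq_norm] using hA
        have h2 : ‖(1 : F →L[ℝ] F)‖ ≤ 1 := ContinuousLinearMap.norm_id_le
        have h3 := norm_add_le (A - 1) 1
        rw [sub_add_cancel] at h3
        linarith
      calc ‖B t * A‖ ≤ ‖B t‖ * ‖A‖ := norm_mul_le _ _
        _ ≤ K * 2 := by gcongr; exact hK t
        _ = _ := by push_cast; ring
    · simp only [sub_zero, sub_neg_eq_add, zero_add, max_self, NNReal.coe_mul, NNReal.coe_ofNat,
        NNReal.coe_one, NNReal.coe_zero, ε]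
      rw [← div_eq_mul_inv, div_le_one (by positivity)]
      linarith
  obtain ⟨A, hA0, hA⟩ := hpl.exists_eq_forall_mem_Icc_hasDerivWithinAt₀
  refine ⟨A, hA0, fun t ht => ?_⟩
  rw [abs_lt] at ht
  exact (hA t ⟨ht.1.le, ht.2.le⟩).hasDerivAt (Icc_mem_nhds ht.1 ht.2)

end Gronwall

section Flow

variable {F : Type*} [NormedAddCommGroup F] [NormedSpace ℝ F] {ξ : F → F} {Φ : ℝ → F → F}

/-- Quadratic Taylor estimate for a map with Lipschitz derivative. -/
theorem norm_sub_sub_fderiv_le {G : Type*} [NormedAddCommGroup G] [NormedSpace ℝ G] {f : F → G}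
    (hf : Differentiable ℝ f) {M : NNReal}
    (hM : LipschitzWith M (fderiv ℝ f)) (a b : F) :
    ‖f b - f a - fderiv ℝ f a (b - a)‖ ≤ M * ‖b - a‖ ^ 2 := by
  have h := (convex_closedBall a ‖b - a‖).norm_image_sub_le_of_norm_fderiv_le' (𝕜 := ℝ)
    (f := f) (φ := fderiv ℝ f a) (C := M * ‖b - a‖) (x := a) (y := b) (fun x _ => hf x)
    (fun x hx => (hM.norm_sub_le x a).trans (by
      gcongr; exact mem_closedBall_iff_norm.1 hx))
    (Metric.mem_closedBall_self (norm_nonneg _)) (mem_closedBall_iff_norm.2 le_rfl)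
  linarith

theorem flow_comp_flow_neg {K : NNReal} (hK : LipschitzWith K ξ) (hΦ0 : Φ 0 = id)
    (hflow : ∀ y τ, HasDerivAt (fun s => Φ s y) (ξ (Φ τ y)) τ) (τ : ℝ) (y : F) :
    Φ τ (Φ (-τ) y) = y := by
  have h : (fun s => Φ s (Φ (-τ) y)) = fun s => Φ (s - τ) y :=
    ODE_solution_unique_univ (v := fun _ => ξ) (s := fun _ => univ) (K := K) (t₀ := 0)
      (fun _ => hK.lipschitzOnWith) (fun t => ⟨hflow _ t, trivial⟩)
      (fun t => ⟨(hflow y (t - τ)).comp_sub_const t τ, trivial⟩) (by simp [hΦ0])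
  simpa [hΦ0] using congrFun h τ

theorem bijective_flow {K : NNReal} (hK : LipschitzWith K ξ) (hΦ0 : Φ 0 = id)
    (hflow : ∀ y τ, HasDerivAt (fun s => Φ s y) (ξ (Φ τ y)) τ) (τ : ℝ) :
    Function.Bijective (Φ τ) := by
  refine Function.bijective_iff_has_inverse.2 ⟨Φ (-τ), fun y => ?_,
    flow_comp_flow_neg hK hΦ0 hflow τ⟩
  simpa using flow_comp_flow_neg hK hΦ0 hflow (-τ) y

theorem norm_flow_sub_le {K : NNReal} (hK : LipschitzWith K ξ) (hΦ0 : Φ 0 = id)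
    (hflow : ∀ y τ, HasDerivAt (fun s => Φ s y) (ξ (Φ τ y)) τ) (τ : ℝ) (x y : F) :
    ‖Φ τ x - Φ τ y‖ ≤ ‖x - y‖ * Real.exp (K * |τ|) := by
  rw [← gronwallBound_ε0]
  refine norm_le_gronwallBound_abs (w := fun s => Φ s x - Φ s y) (ε := |τ| + 1)
    (fun t _ => (hflow x t).sub (hflow y t)) (by simp [hΦ0]) (fun t _ => ?_) (by linarith)
  simpa using hK.norm_sub_le (Φ t x) (Φ t y)

/-- The flow of a `C^{1,1}` vector field is differentiable in the initial point, its derivative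
being given by the linearised equation. -/
theorem hasFDerivAt_flow {K M : NNReal} (hξ : Differentiable ℝ ξ) (hK : LipschitzWith K ξ)
    (hM : LipschitzWith M (fderiv ℝ ξ)) (hΦ0 : Φ 0 = id)
    (hflow : ∀ y τ, HasDerivAt (fun s => Φ s y) (ξ (Φ τ y)) τ) {ε : ℝ} {y : F}
    {A : ℝ → F →L[ℝ] F} (hA0 : A 0 = 1)
    (hA : ∀ t, |t| < ε → HasDerivAt A (fderiv ℝ ξ (Φ t y) * A t) t) {t : ℝ} (ht : |t| < ε) :
    HasFDerivAt (Φ t) (A t) y := by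
  set c : ℝ := M * Real.exp (K * ε) ^ 2
  have key : ∀ x, ‖Φ t x - Φ t y - A t (x - y)‖ ≤ gronwallBound 0 K c |t| * ‖x - y‖ ^ 2 := by
    intro x
    rw [← gronwallBound_zero_mul]
    refine norm_le_gronwallBound_abs (w := fun s => Φ s x - Φ s y - A s (x - y))
      (fun s hs => ((hflow x s).sub (hflow y s)).sub
        ((hA s hs).clm_apply (hasDerivAt_const s (x - y)))) (by simp [hΦ0, hA0])
      (fun s hs => ?_) ht
    have h1 := norm_sub_sub_fderiv_le hξ hM (Φ s y) (Φ s x)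
    have h2 : ‖fderiv ℝ ξ (Φ s y) (Φ s x - Φ s y - A s (x - y))‖
        ≤ K * ‖Φ s x - Φ s y - A s (x - y)‖ :=
      ContinuousLinearMap.le_of_opNorm_le _ (norm_fderiv_le_of_lipschitz ℝ hK) _
    have h3 : ‖Φ s x - Φ s y‖ ≤ ‖x - y‖ * Real.exp (K * ε) :=
      (norm_flow_sub_le hK hΦ0 hflow s x y).trans (by gcongr)
    have h4 : M * ‖Φ s x - Φ s y‖ ^ 2 ≤ c * ‖x - y‖ ^ 2 :=
      calc M * ‖Φ s x - Φ s y‖ ^ 2 ≤ M * (‖x - y‖ * Real.exp (K * ε)) ^ 2 := by gcongr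
        _ = _ := by simp only [c]; ring
    have h5 := norm_add_le (ξ (Φ s x) - ξ (Φ s y) - fderiv ℝ ξ (Φ s y) (Φ s x - Φ s y))
      (fderiv ℝ ξ (Φ s y) (Φ s x - Φ s y - A s (x - y)))
    have h6 : ξ (Φ s x) - ξ (Φ s y) - ((fderiv ℝ ξ (Φ s y) * A s) (x - y) + A s 0)
        = (ξ (Φ s x) - ξ (Φ s y) - fderiv ℝ ξ (Φ s y) (Φ s x - Φ s y))
          + fderiv ℝ ξ (Φ s y) (Φ s x - Φ s y - A s (x - y)) := by
      simp only [map_sub, map_zero, mul_apply_eq_comp]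
      abel
    rw [h6]
    linarith
  rw [hasFDerivAt_iff_isLittleO]
  refine (Asymptotics.IsBigO.of_bound (gronwallBound 0 K c |t|)
    (Eventually.of_forall fun x => ?_)).trans_isLittleO (Asymptotics.isLittleO_pow_sub_sub y one_lt_two)
  simpa using key x

/-- For short times, uniformly in the initial point, the spatial derivative of the flow of a
`C^{1,1}` vector field exists, is Lipschitz in time at `0`, and has time derivative `Dξ` at `0`. -/
theorem exists_fderiv_flow_estimates [CompleteSpace F] {K M : NNReal} (hξ : Differentiable ℝ ξ)
    (hK : LipschitzWith K ξ) (hM : LipschitzWith M (fderiv ℝ ξ)) (hΦ0 : Φ 0 = id)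
    (hflow : ∀ y τ, HasDerivAt (fun s => Φ s y) (ξ (Φ τ y)) τ) :
    ∃ ε > (0 : ℝ), ∃ C ≥ (0 : ℝ), ∀ y,
      (∀ t, |t| < ε → DifferentiableAt ℝ (Φ t) y ∧ ‖fderiv ℝ (Φ t) y - 1‖ ≤ C * |t|) ∧
      HasDerivAt (fun t => fderiv ℝ (Φ t) y) (fderiv ℝ ξ y) 0 := by
  set ε : ℝ := (2 * K + 1 : ℝ)⁻¹
  have hε : 0 < ε := by positivity
  have hG : 0 ≤ gronwallBound 0 K K ε :=
    (gronwallBound_x0 0 K K).symm.le.trans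
      (gronwallBound_mono le_rfl K.2 K.2 hε.le)
  refine ⟨ε, hε, K * gronwallBound 0 K K ε + K, by positivity, fun y => ?_⟩
  have hcont : Continuous fun t => fderiv ℝ ξ (Φ t y) :=
    hM.continuous.comp (continuous_iff_continuousAt.2 fun t => (hflow y t).continuousAt)
  have hbd : ∀ t, ‖fderiv ℝ ξ (Φ t y)‖ ≤ K := fun t => norm_fderiv_le_of_lipschitz ℝ hK
  obtain ⟨A, hA0, hA⟩ := exists_linear_ode_solution hcont hbd
  have hΦA : ∀ t, |t| < ε → HasFDerivAt (Φ t) (A t) y := fun t ht =>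
    hasFDerivAt_flow hξ hK hM hΦ0 hflow hA0 hA ht
  have hA' : ∀ t, ‖fderiv ℝ ξ (Φ t y) * A t‖ ≤ K * ‖A t - 1‖ + K := fun t =>
    calc ‖fderiv ℝ ξ (Φ t y) * A t‖ ≤ ‖fderiv ℝ ξ (Φ t y)‖ * ‖A t‖ := norm_mul_le _ _
      _ ≤ K * (‖A t - 1‖ + 1) := by
        gcongr
        · exact hbd t
        · calc ‖A t‖ = ‖A t - 1 + 1‖ := by rw [sub_add_cancel]
            _ ≤ ‖A t - 1‖ + ‖(1 : F →L[ℝ] F)‖ := norm_add_le _ _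
            _ ≤ _ := by gcongr; exact ContinuousLinearMap.norm_id_le
      _ = _ := by ring
  have h1 : ∀ t, |t| < ε → ‖A t - 1‖ ≤ gronwallBound 0 K K ε := fun t ht =>
    (norm_le_gronwallBound_abs (w := fun s => A s - 1) (fun s hs => (hA s hs).sub_const 1)
      (by simp [hA0]) (fun s _ => hA' s) ht).trans (gronwallBound_mono le_rfl K.2 K.2 ht.le)
  refine ⟨fun t ht => ⟨(hΦA t ht).differentiableAt, ?_⟩, ?_⟩
  · rw [(hΦA t ht).fderiv]
    have := norm_le_gronwallBound_abs (w := fun s => A s - 1) (K := 0) (δ := 0)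
      (η := K * gronwallBound 0 K K ε + K) (fun s hs => (hA s hs).sub_const 1)
      (by simp [hA0]) (fun s hs => (hA' s).trans (by
        rw [zero_mul, zero_add]; gcongr; exact h1 s hs)) ht
    simpa [gronwallBound_K0] using this
  · have h0 := hA 0 (by rwa [abs_zero])
    rw [hA0, hΦ0, mul_one] at h0
    refine h0.congr_of_eventuallyEq ?_
    filter_upwards [Metric.ball_mem_nhds (0 : ℝ) hε] with t ht
    exact (hΦA t (by simpa using ht)).fderiv

end Flow

/-- Differentiation under the integral sign, assuming a Lipschitz bound only at the center. -/
theorem hasDerivAt_integral_of_dominated_loc_of_lip_center {α : Type*} [MeasurableSpace α]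
    {μ : Measure α} {G : ℝ → α → ℝ} {G' bound : α → ℝ} {x₀ : ℝ} {s : Set ℝ} (hs : s ∈ 𝓝 x₀)
    (hG_meas : ∀ x ∈ s, AEStronglyMeasurable (G x) μ) (hG_int : Integrable (G x₀) μ)
    (hG'_meas : AEStronglyMeasurable G' μ)
    (h_lip : ∀ a, ∀ x ∈ s, ‖G x a - G x₀ a‖ ≤ bound a * ‖x - x₀‖)
    (bound_int : Integrable bound μ) (h_diff : ∀ a, HasDerivAt (G · a) (G' a) x₀) :
    HasDerivAt (fun x => ∫ a, G x a ∂μ) (∫ a, G' a ∂μ) x₀ := by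
  have h := hasFDerivAt_integral_of_dominated_loc_of_lip' (𝕜 := ℝ)
    (F' := fun a => ContinuousLinearMap.toSpanSingleton ℝ (G' a)) hs hG_meas hG_int
    ((ContinuousLinearMap.toSpanSingletonCLE (𝕜 := ℝ) (E := ℝ)).continuous.comp_aestronglyMeasurable
      hG'_meas)
    (Eventually.of_forall h_lip) bound_int
    (Eventually.of_forall fun a => (h_diff a).hasFDerivAt)
  simpa [ContinuousLinearMap.integral_apply h.1] using h.2.hasDerivAt

/-- Change of variables in the entropy integral under a diffeomorphism. -/
theorem integral_entropy_comp_eq {E : Type*} [NormedAddCommGroup E] [NormedSpace ℝ E]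
    [FiniteDimensional ℝ E] [MeasurableSpace E] [BorelSpace E] (μ : Measure E)
    [μ.IsAddHaarMeasure] {T : E → E} (hT : Function.Bijective T) (hTd : Differentiable ℝ T)
    (hpos : ∀ y, 0 < (fderiv ℝ T y).det) {ρ σ : E → ℝ}
    (hpush : ∀ y, σ (T y) * (fderiv ℝ T y).det = ρ y) :
    ∫ x, σ x * Real.log (σ x) ∂μ =
      ∫ y, (ρ y * Real.log (ρ y) - ρ y * Real.log (fderiv ℝ T y).det) ∂μ := by
  have h := integral_image_eq_integral_abs_det_fderiv_smul μ MeasurableSet.univ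
    (fun x _ => (hTd x).hasFDerivAt.hasFDerivWithinAt) hT.1.injOn
    (fun x => σ x * Real.log (σ x))
  rw [image_univ, hT.2.range_eq, setIntegral_univ, setIntegral_univ] at h
  rw [h]
  congr 1 with y
  rw [abs_of_pos (hpos y), smul_eq_mul, ← hpush y]
  rcases eq_or_ne (σ (T y)) 0 with h0 | h0
  · simp [h0]
  · rw [Real.log_mul h0 (hpos y).ne']
    ring

/-- Let `ξ` be a smooth compactly supported vector field on `ℝⁿ` with flow
`Φ_τ` (`∂_τ Φ_τ(y) = ξ(Φ_τ(y))`, `Φ_0 = id`). Let `ρ` be a probability density with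
`∫ ρ |log ρ| < ∞`, and let `ρ_τ` be the density of the push-forward of `ρ(y) dy` under `Φ_τ`,
i.e. `ρ_τ(Φ_τ(y)) · det ∇Φ_τ(y) = ρ(y)`. Then the entropy `S(ρ_τ) = ∫ ρ_τ log ρ_τ` is
differentiable in `τ` at `τ = 0` with derivative `−∫ ρ(y) div ξ(y) dy`. -/
theorem entropy_derivative_along_pushforward_flow
    (n : ℕ)
    (ξ : EuclideanSpace ℝ (Fin n) → EuclideanSpace ℝ (Fin n))
    (hξ : ContDiff ℝ (⊤ : ℕ∞) ξ) (hξsupp : HasCompactSupport ξ)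
    (Φ : ℝ → EuclideanSpace ℝ (Fin n) → EuclideanSpace ℝ (Fin n))
    (hΦ0 : Φ 0 = id)
    (hflow : ∀ y τ, HasDerivAt (fun s => Φ s y) (ξ (Φ τ y)) τ)
    (ρ : EuclideanSpace ℝ (Fin n) → ℝ)
    (hρmeas : Measurable ρ) (hρnn : ∀ x, 0 ≤ ρ x) (hρ1 : ∫ x, ρ x = 1)
    (hρlog : Integrable (fun x => ρ x * |Real.log (ρ x)|))
    (ρτ : ℝ → EuclideanSpace ℝ (Fin n) → ℝ)
    (hρτmeas : ∀ τ, Measurable (ρτ τ)) (hρτnn : ∀ τ x, 0 ≤ ρτ τ x)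
    (hpush : ∀ τ y, ρτ τ (Φ τ y) * (fderiv ℝ (Φ τ) y).det = ρ y) :
    HasDerivAt (fun τ => ∫ x, ρτ τ x * Real.log (ρτ τ x))
      (-∫ y, ρ y *
        ∑ i : Fin n, fderiv ℝ (fun z => ξ z i) y (EuclideanSpace.single i 1)) 0 := by
  have hdξ : Differentiable ℝ ξ := hξ.differentiable (by simp)
  obtain ⟨K, hK⟩ := hξ.lipschitzWith_of_hasCompactSupport hξsupp (by simp)
  obtain ⟨M, hM⟩ := ContDiff.lipschitzWith_of_hasCompactSupport (𝕂 := ℝ) (hξsupp.fderiv ℝ)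
    (hξ.fderiv_right (m := (⊤ : ℕ∞)) (by simp)) (by simp)
  obtain ⟨ε, hε, C, hC, hflowD⟩ := exists_fderiv_flow_estimates hdξ hK hM hΦ0 hflow
  obtain ⟨δ, hδ, L, hL⟩ := EuclideanSpace.exists_abs_log_det_le (n := n)
  have hρint : Integrable ρ := by
    by_contra h
    rw [integral_undef h] at hρ1
    exact zero_ne_one hρ1
  have hρlog' : Integrable (fun x => ρ x * Real.log (ρ x)) :=
    hρlog.mono (hρmeas.mul hρmeas.log).aestronglyMeasurable (by simp)
  have hdet0 : ∀ y, (fderiv ℝ (Φ 0) y).det = 1 := fun y => by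
    rw [hΦ0, fderiv_id]; exact LinearMap.det_id
  -- On `|t| < η` the derivative of the flow stays in the neighborhood of `1` given by `δ`.
  set η := min ε (δ / (C + 1))
  have hη : 0 < η := lt_min hε (by positivity)
  have hlog : ∀ t, |t| < η → ∀ y, 0 < (fderiv ℝ (Φ t) y).det ∧
      |Real.log (fderiv ℝ (Φ t) y).det| ≤ |L| * C * |t| := by
    intro t ht y
    have h1 := ((hflowD y).1 t (ht.trans_le (min_le_left _ _))).2
    have h2 : |t| * (C + 1) < δ := (lt_div_iff₀ (by positivity)).1 (ht.trans_le (min_le_right _ _))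
    obtain ⟨hp, hb⟩ := hL (fderiv ℝ (Φ t) y) (by nlinarith [abs_nonneg t])
    refine ⟨hp, hb.trans ?_⟩
    calc L * ‖fderiv ℝ (Φ t) y - 1‖ ≤ |L| * (C * |t|) := by gcongr; exact le_abs_self L
      _ = _ := by ring
  have hS : ∀ t, |t| < η → ∫ x, ρτ t x * Real.log (ρτ t x) =
      ∫ y, (ρ y * Real.log (ρ y) - ρ y * Real.log (fderiv ℝ (Φ t) y).det) := fun t ht =>
    integral_entropy_comp_eq volume (bijective_flow hK hΦ0 hflow t)
      (fun y => ((hflowD y).1 t (ht.trans_le (min_le_left _ _))).1) (fun y => (hlog t ht y).1)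
      (hpush t)
  have hball : Metric.ball (0 : ℝ) η ∈ 𝓝 0 := Metric.ball_mem_nhds 0 hη
  have hmeas : ∀ t, Measurable fun y => Real.log (fderiv ℝ (Φ t) y).det := fun t =>
    (ContinuousLinearMap.continuous_det.measurable.comp (measurable_fderiv ℝ (Φ t))).log
  have hdiv : ∀ y, ∑ i : Fin n, fderiv ℝ (fun z => ξ z i) y (EuclideanSpace.single i 1) =
      ∑ i, fderiv ℝ ξ y (EuclideanSpace.single i 1) i := fun y =>
    Finset.sum_congr rfl fun i _ => by
      have := ((EuclideanSpace.proj (𝕜 := ℝ) i).hasFDerivAt.comp y (hdξ y).hasFDerivAt).fderiv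
      exact congrArg (· (EuclideanSpace.single i 1)) this
  simp_rw [hdiv, ← integral_neg]
  have hdivmeas : Continuous fun y => ∑ i, fderiv ℝ ξ y (EuclideanSpace.single i 1) i := by
    have := hM.continuous
    fun_prop
  refine HasDerivAt.congr_of_eventuallyEq (f := fun t =>
    ∫ y, (ρ y * Real.log (ρ y) - ρ y * Real.log (fderiv ℝ (Φ t) y).det)) ?_
    (by filter_upwards [hball] with t ht using hS t (by simpa using ht))
  refine hasDerivAt_integral_of_dominated_loc_of_lip_center
    (bound := fun y => ρ y * (|L| * C)) hball
    (fun t _ => ((hρmeas.mul hρmeas.log).sub (hρmeas.mul (hmeas t))).aestronglyMeasurable)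
    (by simpa [hdet0] using hρlog')
    (hρmeas.mul hdivmeas.measurable).neg.aestronglyMeasurable
    (fun y t ht => ?_) (hρint.mul_const _) (fun y => ?_)
  · have h1 := (hlog t (by simpa using ht) y).2
    rw [hdet0, Real.log_one, mul_zero, sub_zero, sub_sub_cancel_left, norm_neg, norm_mul,
      Real.norm_of_nonneg (hρnn y), Real.norm_eq_abs, Real.norm_eq_abs, sub_zero, mul_assoc]
    exact mul_le_mul_of_nonneg_left h1 (hρnn y)
  · have h1 : fderiv ℝ (Φ 0) y = 1 := by rw [hΦ0]; exact fderiv_id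
    exact ((EuclideanSpace.hasDerivAt_log_det h1 (hflowD y).2).const_mul (ρ y)).const_sub _
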